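/- The assignment S(u) ↦ S + q⁻¹ u⁻¹ S̄, i.e. s_ij^{(0)} ↦ s_ij, s_ij^{(1)} ↦ q⁻¹ s̄_ij, and s_ij^{(r)} ↦ 0 for r ≥ 2, defines an algebra homomorphism (the evaluation homomorphism) from the twisted q-Yangian Y^tw_q(o_N) onto the twisted quantized enveloping algebra U^tw_q(o_N). Here S̄ = T̄ Tᵗ, whose entries lie in U^tw_q(o_N) since S̄ is upper triangular with s̄_ii = 1 and s̄_ij = q s_ji for i < j. -/

import Mathlib

noncomputable section

open scoped TensorProduct

abbrev FF : Type := RatFunc ℂ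

def qq : FF := RatFunc.X

/-! Constant R-matrices acting in `ℂ^N ⊗ ℂ^N`, written as matrices indexed by pairs. -/

def Rc (F : Type) [Field F] (q : F) (N : ℕ) :
    Matrix (Fin N × Fin N) (Fin N × Fin N) F := Matrix.of fun p r =>
  (if p = r then (if p.1 = p.2 then q else 1) else 0)
  + (if p.1 = r.2 ∧ p.2 = r.1 ∧ p.1 < p.2 then q - q⁻¹ else 0)

/-- `R` transposed in the first tensor factor. -/
def Rct (F : Type) [Field F] (q : F) (N : ℕ) :
    Matrix (Fin N × Fin N) (Fin N × Fin N) F :=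
  Matrix.of fun p r => Rc F q N (r.1, p.2) (p.1, r.2)

def Rtil (F : Type) [Field F] (q : F) (N : ℕ) :
    Matrix (Fin N × Fin N) (Fin N × Fin N) F := Matrix.of fun p r =>
  (if p = r then (if p.1 = p.2 then q⁻¹ else 1) else 0)
  + (if p.1 = r.2 ∧ p.2 = r.1 ∧ p.2 < p.1 then q⁻¹ - q else 0)

def Rtilt (F : Type) [Field F] (q : F) (N : ℕ) :
    Matrix (Fin N × Fin N) (Fin N × Fin N) F :=
  Matrix.of fun p r => Rtil F q N (r.1, p.2) (p.1, r.2)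

/-- `S ↦ S ⊗ 1` (action in the first copy of `End ℂ^N`). -/
def amp1 {A : Type} [Ring A] {N : ℕ} (M : Matrix (Fin N) (Fin N) A) :
    Matrix (Fin N × Fin N) (Fin N × Fin N) A :=
  Matrix.of fun p r => if p.2 = r.2 then M p.1 r.1 else 0

/-- `S ↦ 1 ⊗ S` (action in the second copy of `End ℂ^N`). -/
def amp2 {A : Type} [Ring A] {N : ℕ} (M : Matrix (Fin N) (Fin N) A) :
    Matrix (Fin N × Fin N) (Fin N × Fin N) A :=
  Matrix.of fun p r => if p.1 = r.1 then M p.2 r.2 else 0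

/-- A scalar matrix viewed as a matrix over an `F`-algebra `A`. -/
def liftF (F : Type) [Field F] {A : Type} [Ring A] [Algebra F A] {m : Type}
    (M : Matrix m m F) : Matrix m m A := M.map (algebraMap F A)

/-- Left hand side `R S₁ Rᵗ S₂` of the reflection equation. -/
def reflLHS (F : Type) [Field F] (q : F) {N : ℕ} {A : Type} [Ring A] [Algebra F A]
    (S : Matrix (Fin N) (Fin N) A) : Matrix (Fin N × Fin N) (Fin N × Fin N) A :=
  liftF F (Rc F q N) * amp1 S * liftF F (Rct F q N) * amp2 S

/-- Right hand side `S₂ Rᵗ S₁ R` of the reflection equation. -/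
def reflRHS (F : Type) [Field F] (q : F) {N : ℕ} {A : Type} [Ring A] [Algebra F A]
    (S : Matrix (Fin N) (Fin N) A) : Matrix (Fin N × Fin N) (Fin N × Fin N) A :=
  amp2 S * liftF F (Rct F q N) * amp1 S * liftF F (Rc F q N)

/-- The list of index pairs `(i,j)` in lexicographic order. -/
def lexPairs (N : ℕ) : List (Fin N × Fin N) :=
  (List.finRange N).flatMap fun i => (List.finRange N).map fun j => (i, j)

/-! The generic matrix of generators. -/

def Sfree (F : Type) [Field F] (N : ℕ) :
    Matrix (Fin N) (Fin N) (FreeAlgebra F (Fin N × Fin N)) :=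
  Matrix.of fun i j => FreeAlgebra.ι F (i, j)

/-- Defining relations: only the reflection equation. -/
inductive Rel0 (F : Type) [Field F] (q : F) (N : ℕ) :
    FreeAlgebra F (Fin N × Fin N) → FreeAlgebra F (Fin N × Fin N) → Prop
  | refl (p r : Fin N × Fin N) :
      Rel0 F q N (reflLHS F q (Sfree F N) p r) (reflRHS F q (Sfree F N) p r)

/-- The algebra with generators `s_ij` and the reflection equation as defining relations. -/
abbrev Alg0 (F : Type) [Field F] (q : F) (N : ℕ) := RingQuot (Rel0 F q N)

def s0 (F : Type) [Field F] (q : F) (N : ℕ) (i j : Fin N) : Alg0 F q N :=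
  RingQuot.mkAlgHom F (Rel0 F q N) (FreeAlgebra.ι F (i, j))

/-- Defining relations of the presented algebra `𝒮` of the orthogonal case. -/
inductive OSRel (F : Type) [Field F] (q : F) (N : ℕ) :
    FreeAlgebra F (Fin N × Fin N) → FreeAlgebra F (Fin N × Fin N) → Prop
  | tri (i j : Fin N) (h : i < j) : OSRel F q N (FreeAlgebra.ι F (i, j)) 0
  | diag (i : Fin N) : OSRel F q N (FreeAlgebra.ι F (i, i)) 1
  | refl (p r : Fin N × Fin N) :
      OSRel F q N (reflLHS F q (Sfree F N) p r) (reflRHS F q (Sfree F N) p r)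

abbrev AlgOS (F : Type) [Field F] (q : F) (N : ℕ) := RingQuot (OSRel F q N)

def sOS (F : Type) [Field F] (q : F) (N : ℕ) (i j : Fin N) : AlgOS F q N :=
  RingQuot.mkAlgHom F (OSRel F q N) (FreeAlgebra.ι F (i, j))

/-! The quantized enveloping algebra `U_q(gl_N)` by its RTT presentation. -/

abbrev GlGen (N : ℕ) := (Fin N × Fin N) ⊕ (Fin N × Fin N)

def Tfree (F : Type) [Field F] (N : ℕ) :
    Matrix (Fin N) (Fin N) (FreeAlgebra F (GlGen N)) :=
  Matrix.of fun i j => FreeAlgebra.ι F (Sum.inl (i, j))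

def Tbfree (F : Type) [Field F] (N : ℕ) :
    Matrix (Fin N) (Fin N) (FreeAlgebra F (GlGen N)) :=
  Matrix.of fun i j => FreeAlgebra.ι F (Sum.inr (i, j))

/-- `R X₁ Y₂` -/
def rttLHS (F : Type) [Field F] (q : F) {N : ℕ} {A : Type} [Ring A] [Algebra F A]
    (X Y : Matrix (Fin N) (Fin N) A) : Matrix (Fin N × Fin N) (Fin N × Fin N) A :=
  liftF F (Rc F q N) * amp1 X * amp2 Y

/-- `Y₂ X₁ R` -/
def rttRHS (F : Type) [Field F] (q : F) {N : ℕ} {A : Type} [Ring A] [Algebra F A]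
    (X Y : Matrix (Fin N) (Fin N) A) : Matrix (Fin N × Fin N) (Fin N × Fin N) A :=
  amp2 Y * amp1 X * liftF F (Rc F q N)

inductive GlRel (F : Type) [Field F] (q : F) (N : ℕ) :
    FreeAlgebra F (GlGen N) → FreeAlgebra F (GlGen N) → Prop
  | t_zero (i j : Fin N) (h : i < j) : GlRel F q N (Tfree F N i j) 0
  | tb_zero (i j : Fin N) (h : j < i) : GlRel F q N (Tbfree F N i j) 0
  | t_tb (i : Fin N) : GlRel F q N (Tfree F N i i * Tbfree F N i i) 1
  | tb_t (i : Fin N) : GlRel F q N (Tbfree F N i i * Tfree F N i i) 1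
  | rtt (p r : Fin N × Fin N) :
      GlRel F q N (rttLHS F q (Tfree F N) (Tfree F N) p r)
        (rttRHS F q (Tfree F N) (Tfree F N) p r)
  | rtbtb (p r : Fin N × Fin N) :
      GlRel F q N (rttLHS F q (Tbfree F N) (Tbfree F N) p r)
        (rttRHS F q (Tbfree F N) (Tbfree F N) p r)
  | rtbt (p r : Fin N × Fin N) :
      GlRel F q N (rttLHS F q (Tbfree F N) (Tfree F N) p r)
        (rttRHS F q (Tbfree F N) (Tfree F N) p r)

/-- The quantized enveloping algebra `U_q(gl_N)`. -/
abbrev UqGl (F : Type) [Field F] (q : F) (N : ℕ) := RingQuot (GlRel F q N)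

def tE (F : Type) [Field F] (q : F) (N : ℕ) (i j : Fin N) : UqGl F q N :=
  RingQuot.mkAlgHom F (GlRel F q N) (FreeAlgebra.ι F (Sum.inl (i, j)))

def tbE (F : Type) [Field F] (q : F) (N : ℕ) (i j : Fin N) : UqGl F q N :=
  RingQuot.mkAlgHom F (GlRel F q N) (FreeAlgebra.ι F (Sum.inr (i, j)))

/-- The entries `s_ij = Σ_a t_ia t̄_ja` of `S = T T̄ᵗ`. -/
def sE (F : Type) [Field F] (q : F) (N : ℕ) (i j : Fin N) : UqGl F q N :=
  ∑ a : Fin N, tE F q N i a * tbE F q N j a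

/-- The twisted quantized enveloping algebra `U^tw_q(o_N)` as a subalgebra of `U_q(gl_N)`. -/
def UtwO (F : Type) [Field F] (q : F) (N : ℕ) : Subalgebra F (UqGl F q N) :=
  Algebra.adjoin F {x | ∃ i j, x = sE F q N i j}

/-! Symplectic (finite) case. -/

/-- `2k` as an element of `Fin (2n)` (the 0-based version of the odd index `2k-1`). -/
def fe (n : ℕ) (k : Fin n) : Fin (2 * n) := ⟨2 * k.val, by have := k.isLt; omega⟩

/-- `2k+1` as an element of `Fin (2n)` (the 0-based version of the even index `2k`). -/
def fo (n : ℕ) (k : Fin n) : Fin (2 * n) := ⟨2 * k.val + 1, by have := k.isLt; omega⟩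

/-- The entries `s_ij` of `S = T G T̄ᵗ` in `U_q(gl_2n)`. -/
def sSp (F : Type) [Field F] (q : F) (n : ℕ) (i j : Fin (2 * n)) : UqGl F q (2 * n) :=
  algebraMap F _ q * ∑ a : Fin n, tE F q (2 * n) i (fe n a) * tbE F q (2 * n) j (fo n a)
    - ∑ a : Fin n, tE F q (2 * n) i (fo n a) * tbE F q (2 * n) j (fe n a)

abbrev SpGen (n : ℕ) := (Fin (2 * n) × Fin (2 * n)) ⊕ Fin n

def SpFreeS (F : Type) [Field F] (n : ℕ) :
    Matrix (Fin (2 * n)) (Fin (2 * n)) (FreeAlgebra F (SpGen n)) :=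
  Matrix.of fun i j => FreeAlgebra.ι F (Sum.inl (i, j))

/-- Defining relations of the presented algebra `𝒮` of the symplectic case. -/
inductive SpRel (F : Type) [Field F] (q : F) (n : ℕ) :
    FreeAlgebra F (SpGen n) → FreeAlgebra F (SpGen n) → Prop
  | tri (i j : Fin (2 * n)) (h : i < j) (h' : ¬(i.val % 2 = 0 ∧ j.val = i.val + 1)) :
      SpRel F q n (FreeAlgebra.ι F (Sum.inl (i, j))) 0
  | quad (k : Fin n) :
      SpRel F q n
        (FreeAlgebra.ι F (Sum.inl (fo n k, fo n k)) * FreeAlgebra.ι F (Sum.inl (fe n k, fe n k)))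
        (algebraMap F _ (q ^ 2) *
            (FreeAlgebra.ι F (Sum.inl (fo n k, fe n k)) *
              FreeAlgebra.ι F (Sum.inl (fe n k, fo n k)))
          + algebraMap F _ (q ^ 3))
  | invR (k : Fin n) :
      SpRel F q n
        (FreeAlgebra.ι F (Sum.inl (fe n k, fo n k)) * FreeAlgebra.ι F (Sum.inr k)) 1
  | invL (k : Fin n) :
      SpRel F q n
        (FreeAlgebra.ι F (Sum.inr k) * FreeAlgebra.ι F (Sum.inl (fe n k, fo n k))) 1
  | refl (p r : Fin (2 * n) × Fin (2 * n)) :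
      SpRel F q n (reflLHS F q (SpFreeS F n) p r) (reflRHS F q (SpFreeS F n) p r)

abbrev AlgSp (F : Type) [Field F] (q : F) (n : ℕ) := RingQuot (SpRel F q n)

def sSpP (F : Type) [Field F] (q : F) (n : ℕ) (i j : Fin (2 * n)) : AlgSp F q n :=
  RingQuot.mkAlgHom F (SpRel F q n) (FreeAlgebra.ι F (Sum.inl (i, j)))

def sInvP (F : Type) [Field F] (q : F) (n : ℕ) (k : Fin n) : AlgSp F q n :=
  RingQuot.mkAlgHom F (SpRel F q n) (FreeAlgebra.ι F (Sum.inr k))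

/-- row `i = 2k` of the symplectic ordered monomial: positions `(i,0),…,(i,2k)`. -/
def rowA (n : ℕ) (k : Fin n) : List (Fin (2 * n) × Fin (2 * n)) :=
  ((List.finRange (2 * n)).filter fun j => j.val ≤ 2 * k.val).map fun j => (fe n k, j)

/-- row `i' = 2k+1` of the symplectic ordered monomial: positions `(i',0),…,(i',2k-1)`. -/
def rowB (n : ℕ) (k : Fin n) : List (Fin (2 * n) × Fin (2 * n)) :=
  ((List.finRange (2 * n)).filter fun j => j.val + 2 ≤ 2 * k.val + 1).map fun j => (fo n k, j)

/-- The ordered monomials of the symplectic case, with an arbitrary integer exponent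
on each `s_{i i'}` and nonnegative exponents elsewhere. -/
def monomSp {A : Type} [Ring A] (n : ℕ) (s : Fin (2 * n) × Fin (2 * n) → A) (sI : Fin n → A)
    (kN : Fin (2 * n) × Fin (2 * n) → ℕ) (kZ : Fin n → ℤ) : A :=
  ((List.finRange n).map fun k =>
    ((rowA n k).map fun p => s p ^ kN p).prod *
      (if 0 ≤ kZ k then s (fe n k, fo n k) ^ (kZ k).toNat else sI k ^ (-(kZ k)).toNat) *
      s (fo n k, fo n k) ^ kN (fo n k, fo n k) *
      ((rowB n k).map fun p => s p ^ kN p).prod).prod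

/-! Affine (twisted q-Yangian) machinery.  Series are treated coefficientwise. -/

/-- `z1 S r` is the coefficient matrix (in the first copy) of a series indexed by
nonnegative integers, extended by zero to `ℤ`. -/
def z1 {A : Type} [Ring A] {N : ℕ} (S : ℕ → Matrix (Fin N) (Fin N) A) (r : ℤ) :
    Matrix (Fin N × Fin N) (Fin N × Fin N) A :=
  if 0 ≤ r then amp1 (S r.toNat) else 0

def z2 {A : Type} [Ring A] {N : ℕ} (S : ℕ → Matrix (Fin N) (Fin N) A) (r : ℤ) :
    Matrix (Fin N × Fin N) (Fin N × Fin N) A :=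
  if 0 ≤ r then amp2 (S r.toNat) else 0

/-- Coefficient of `u^a v^b` in `R(u,v) S₁(u) Rᵗ(u⁻¹,v) S₂(v)`,
using `R(u,v) = u R̃ - v R` and `Rᵗ(u⁻¹,v) = u⁻¹ R̃ᵗ - v Rᵗ`. -/
def affLHS (F : Type) [Field F] (q : F) {N : ℕ} {A : Type} [Ring A] [Algebra F A]
    (S : ℕ → Matrix (Fin N) (Fin N) A) (a b : ℤ) :
    Matrix (Fin N × Fin N) (Fin N × Fin N) A :=
  liftF F (Rtil F q N) * z1 S (-a) * liftF F (Rtilt F q N) * z2 S (-b)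
    - liftF F (Rtil F q N) * z1 S (1 - a) * liftF F (Rct F q N) * z2 S (1 - b)
    - liftF F (Rc F q N) * z1 S (-1 - a) * liftF F (Rtilt F q N) * z2 S (1 - b)
    + liftF F (Rc F q N) * z1 S (-a) * liftF F (Rct F q N) * z2 S (2 - b)

/-- Coefficient of `u^a v^b` in `S₂(v) Rᵗ(u⁻¹,v) S₁(u) R(u,v)`. -/
def affRHS (F : Type) [Field F] (q : F) {N : ℕ} {A : Type} [Ring A] [Algebra F A]
    (S : ℕ → Matrix (Fin N) (Fin N) A) (a b : ℤ) :
    Matrix (Fin N × Fin N) (Fin N × Fin N) A :=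
  z2 S (-b) * liftF F (Rtilt F q N) * z1 S (-a) * liftF F (Rtil F q N)
    - z2 S (1 - b) * liftF F (Rtilt F q N) * z1 S (-1 - a) * liftF F (Rc F q N)
    - z2 S (1 - b) * liftF F (Rct F q N) * z1 S (1 - a) * liftF F (Rtil F q N)
    + z2 S (2 - b) * liftF F (Rct F q N) * z1 S (-a) * liftF F (Rc F q N)

def SfreeA (F : Type) [Field F] (N : ℕ) (r : ℕ) :
    Matrix (Fin N) (Fin N) (FreeAlgebra F (ℕ × Fin N × Fin N)) :=
  Matrix.of fun i j => FreeAlgebra.ι F (r, i, j)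

/-- Defining relations: only the affine reflection equation (coefficientwise). -/
inductive Rel9 (F : Type) [Field F] (q : F) (N : ℕ) :
    FreeAlgebra F (ℕ × Fin N × Fin N) → FreeAlgebra F (ℕ × Fin N × Fin N) → Prop
  | refl (a b : ℤ) (p r : Fin N × Fin N) :
      Rel9 F q N (affLHS F q (SfreeA F N) a b p r) (affRHS F q (SfreeA F N) a b p r)

abbrev Alg9 (F : Type) [Field F] (q : F) (N : ℕ) := RingQuot (Rel9 F q N)

def s9 (F : Type) [Field F] (q : F) (N : ℕ) (r : ℕ) (i j : Fin N) : Alg9 F q N :=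
  RingQuot.mkAlgHom F (Rel9 F q N) (FreeAlgebra.ι F (r, i, j))

/-- Defining relations of the presented twisted q-Yangian (orthogonal case). -/
inductive AORel (F : Type) [Field F] (q : F) (N : ℕ) :
    FreeAlgebra F (ℕ × Fin N × Fin N) → FreeAlgebra F (ℕ × Fin N × Fin N) → Prop
  | tri (i j : Fin N) (h : i < j) : AORel F q N (FreeAlgebra.ι F (0, i, j)) 0
  | diag (i : Fin N) : AORel F q N (FreeAlgebra.ι F (0, i, i)) 1
  | refl (a b : ℤ) (p r : Fin N × Fin N) :
      AORel F q N (affLHS F q (SfreeA F N) a b p r) (affRHS F q (SfreeA F N) a b p r)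

abbrev AlgAO (F : Type) [Field F] (q : F) (N : ℕ) := RingQuot (AORel F q N)

def sAO (F : Type) [Field F] (q : F) (N : ℕ) (r : ℕ) (i j : Fin N) : AlgAO F q N :=
  RingQuot.mkAlgHom F (AORel F q N) (FreeAlgebra.ι F (r, i, j))

/-- Lexicographic (non-strict) comparison of triples. -/
def tripLe (x y : ℕ × ℕ × ℕ) : Prop :=
  x.1 < y.1 ∨ (x.1 = y.1 ∧ (x.2.1 < y.2.1 ∨ (x.2.1 = y.2.1 ∧ x.2.2 ≤ y.2.2)))

/-- A list of generator indices `(r,i,j)` is ordered if it is weakly increasing with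
respect to the lexicographic order on `(r,i,j)`. -/
def sortedGens {N : ℕ} (l : List (ℕ × Fin N × Fin N)) : Prop :=
  l.Chain' fun x y => tripLe (x.1, x.2.1.val, x.2.2.val) (y.1, y.2.1.val, y.2.2.val)

/-! The quantum affine algebra `U_q(ĝl_N)` by its RTT presentation, coefficientwise. -/

abbrev AffGen (N : ℕ) := (ℕ × Fin N × Fin N) ⊕ (ℕ × Fin N × Fin N)

def TfA (F : Type) [Field F] (N : ℕ) (r : ℕ) :
    Matrix (Fin N) (Fin N) (FreeAlgebra F (AffGen N)) :=
  Matrix.of fun i j => FreeAlgebra.ι F (Sum.inl (r, i, j))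

def TbfA (F : Type) [Field F] (N : ℕ) (r : ℕ) :
    Matrix (Fin N) (Fin N) (FreeAlgebra F (AffGen N)) :=
  Matrix.of fun i j => FreeAlgebra.ι F (Sum.inr (r, i, j))

/-- Coefficient of `u^a v^b` in `R(u,v) X₁ Y₂` with prescribed coefficient extractions. -/
def affRttL (F : Type) [Field F] (q : F) {N : ℕ} {A : Type} [Ring A] [Algebra F A]
    (X Y : ℕ → Matrix (Fin N) (Fin N) A) (a b a' b' : ℤ) :
    Matrix (Fin N × Fin N) (Fin N × Fin N) A :=
  liftF F (Rtil F q N) * z1 X a * z2 Y b - liftF F (Rc F q N) * z1 X a' * z2 Y b'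

def affRttR (F : Type) [Field F] (q : F) {N : ℕ} {A : Type} [Ring A] [Algebra F A]
    (X Y : ℕ → Matrix (Fin N) (Fin N) A) (a b a' b' : ℤ) :
    Matrix (Fin N × Fin N) (Fin N × Fin N) A :=
  z2 Y b * z1 X a * liftF F (Rtil F q N) - z2 Y b' * z1 X a' * liftF F (Rc F q N)

inductive AffGlRel (F : Type) [Field F] (q : F) (N : ℕ) :
    FreeAlgebra F (AffGen N) → FreeAlgebra F (AffGen N) → Prop
  | t0_tri (i j : Fin N) (h : i < j) : AffGlRel F q N (TfA F N 0 i j) 0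
  | tb0_tri (i j : Fin N) (h : j < i) : AffGlRel F q N (TbfA F N 0 i j) 0
  | t_tb (i : Fin N) : AffGlRel F q N (TfA F N 0 i i * TbfA F N 0 i i) 1
  | tb_t (i : Fin N) : AffGlRel F q N (TbfA F N 0 i i * TfA F N 0 i i) 1
  | rtt (a b : ℤ) (p r : Fin N × Fin N) :
      AffGlRel F q N
        (affRttL F q (TfA F N) (TfA F N) (1 - a) (-b) (-a) (1 - b) p r)
        (affRttR F q (TfA F N) (TfA F N) (1 - a) (-b) (-a) (1 - b) p r)
  | rtbtb (a b : ℤ) (p r : Fin N × Fin N) :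
      AffGlRel F q N
        (affRttL F q (TbfA F N) (TbfA F N) (a - 1) b a (b - 1) p r)
        (affRttR F q (TbfA F N) (TbfA F N) (a - 1) b a (b - 1) p r)
  | rtbt (a b : ℤ) (p r : Fin N × Fin N) :
      AffGlRel F q N
        (affRttL F q (TbfA F N) (TfA F N) (a - 1) (-b) a (1 - b) p r)
        (affRttR F q (TbfA F N) (TfA F N) (a - 1) (-b) a (1 - b) p r)

/-- The quantum affine algebra `U_q(ĝl_N)`. -/
abbrev UqAff (F : Type) [Field F] (q : F) (N : ℕ) := RingQuot (AffGlRel F q N)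

def tA (F : Type) [Field F] (q : F) (N : ℕ) (r : ℕ) (i j : Fin N) : UqAff F q N :=
  RingQuot.mkAlgHom F (AffGlRel F q N) (FreeAlgebra.ι F (Sum.inl (r, i, j)))

def tbA (F : Type) [Field F] (q : F) (N : ℕ) (r : ℕ) (i j : Fin N) : UqAff F q N :=
  RingQuot.mkAlgHom F (AffGlRel F q N) (FreeAlgebra.ι F (Sum.inr (r, i, j)))

/-- Coefficient of `u^{-r}` in `s_ij(u) = Σ_a t_ia(u) t̄_ja(u⁻¹)`. -/
def Scoef (F : Type) [Field F] (q : F) (N : ℕ) (r : ℕ) (i j : Fin N) : UqAff F q N :=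
  ∑ a : Fin N, ∑ p ∈ Finset.range (r + 1), tA F q N p i a * tbA F q N (r - p) j a

/-- The twisted q-Yangian `Y^tw_q(o_N)` as a subalgebra of `U_q(ĝl_N)`. -/
def YtwO (F : Type) [Field F] (q : F) (N : ℕ) : Subalgebra F (UqAff F q N) :=
  Algebra.adjoin F {x | ∃ r i j, x = Scoef F q N r i j}

/-- Coefficient of `u^{-r}` in `s_ij(u)`, the `(i,j)` entry of `S(u) = T(u) G T̄(u⁻¹)ᵗ`
in the symplectic case. -/
def ScoefSp (F : Type) [Field F] (q : F) (n : ℕ) (r : ℕ) (i j : Fin (2 * n)) :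
    UqAff F q (2 * n) :=
  ∑ a : Fin n, ∑ p ∈ Finset.range (r + 1),
    (algebraMap F _ q * (tA F q (2 * n) p i (fe n a) * tbA F q (2 * n) (r - p) j (fo n a))
      - tA F q (2 * n) p i (fo n a) * tbA F q (2 * n) (r - p) j (fe n a))

/-- The twisted q-Yangian `Y^tw_q(sp_2n)` as a subalgebra of `U_q(ĝl_2n)`,
with a prescribed family of inverses of `s^{(0)}_{ii'}`. -/
def YtwSp (F : Type) [Field F] (q : F) (n : ℕ) (inv : Fin n → UqAff F q (2 * n)) :
    Subalgebra F (UqAff F q (2 * n)) :=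
  Algebra.adjoin F ({x | ∃ r i j, x = ScoefSp F q n r i j} ∪ Set.range inv)

abbrev ASpGen (n : ℕ) := (ℕ × Fin (2 * n) × Fin (2 * n)) ⊕ Fin n

def SfreeASp (F : Type) [Field F] (n : ℕ) (r : ℕ) :
    Matrix (Fin (2 * n)) (Fin (2 * n)) (FreeAlgebra F (ASpGen n)) :=
  Matrix.of fun i j => FreeAlgebra.ι F (Sum.inl (r, i, j))

/-- Defining relations of the presented twisted q-Yangian (symplectic case). -/
inductive ASpRel (F : Type) [Field F] (q : F) (n : ℕ) :
    FreeAlgebra F (ASpGen n) → FreeAlgebra F (ASpGen n) → Prop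
  | tri (i j : Fin (2 * n)) (h : i < j) (h' : ¬(i.val % 2 = 0 ∧ j.val = i.val + 1)) :
      ASpRel F q n (FreeAlgebra.ι F (Sum.inl (0, i, j))) 0
  | quad (k : Fin n) :
      ASpRel F q n
        (FreeAlgebra.ι F (Sum.inl (0, fo n k, fo n k)) *
          FreeAlgebra.ι F (Sum.inl (0, fe n k, fe n k)))
        (algebraMap F _ (q ^ 2) *
            (FreeAlgebra.ι F (Sum.inl (0, fo n k, fe n k)) *
              FreeAlgebra.ι F (Sum.inl (0, fe n k, fo n k)))
          + algebraMap F _ (q ^ 3))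
  | invR (k : Fin n) :
      ASpRel F q n
        (FreeAlgebra.ι F (Sum.inl (0, fe n k, fo n k)) * FreeAlgebra.ι F (Sum.inr k)) 1
  | invL (k : Fin n) :
      ASpRel F q n
        (FreeAlgebra.ι F (Sum.inr k) * FreeAlgebra.ι F (Sum.inl (0, fe n k, fo n k))) 1
  | refl (a b : ℤ) (p r : Fin (2 * n) × Fin (2 * n)) :
      ASpRel F q n (affLHS F q (SfreeASp F n) a b p r) (affRHS F q (SfreeASp F n) a b p r)

abbrev AlgASp (F : Type) [Field F] (q : F) (n : ℕ) := RingQuot (ASpRel F q n)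

def sASp (F : Type) [Field F] (q : F) (n : ℕ) (r : ℕ) (i j : Fin (2 * n)) : AlgASp F q n :=
  RingQuot.mkAlgHom F (ASpRel F q n) (FreeAlgebra.ι F (Sum.inl (r, i, j)))

def sInvASp (F : Type) [Field F] (q : F) (n : ℕ) (k : Fin n) : AlgASp F q n :=
  RingQuot.mkAlgHom F (ASpRel F q n) (FreeAlgebra.ι F (Sum.inr k))

/-! q-antisymmetrizer and Sklyanin/quantum determinant machinery. -/

/-- The trigonometric R-matrix `R(u,v)`. -/
def Rtrig (F : Type) [Field F] (q : F) (N : ℕ) (u v : F) :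
    Matrix (Fin N × Fin N) (Fin N × Fin N) F := Matrix.of fun p r =>
  (if p = r then (if p.1 = p.2 then q⁻¹ * u - q * v else u - v) else 0)
  + (if p.1 = r.2 ∧ p.2 = r.1 ∧ p.1 ≠ p.2 then
      (q⁻¹ - q) * (if p.2 < p.1 then u else v) else 0)

/-- An operator on `ℂ^N ⊗ ℂ^N` acting in the `i`-th and `j`-th factors of `(ℂ^N)^{⊗ r}`. -/
def big2 (F : Type) [Field F] {N r : ℕ} (i j : Fin r)
    (M : Matrix (Fin N × Fin N) (Fin N × Fin N) F) :
    Matrix (Fin r → Fin N) (Fin r → Fin N) F :=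
  Matrix.of fun f g =>
    if ∀ k, k ≠ i → k ≠ j → f k = g k then M (f i, f j) (g i, g j) else 0

/-- The list of the pairs `(i,j)`, `i < j`, in lexicographic order. -/
def pairsLex (r : ℕ) : List (Fin r × Fin r) :=
  (List.finRange r).flatMap fun i =>
    ((List.finRange r).filter fun j => i < j).map fun j => (i, j)

/-- The number of inversions (the Coxeter length) of a permutation. -/
def invCount {r : ℕ} (σ : Equiv.Perm (Fin r)) : ℕ :=
  (Finset.univ.filter fun p : Fin r × Fin r => p.1 < p.2 ∧ σ p.2 < σ p.1).card

/-- The q-permutation operator `P^q` on `ℂ^N ⊗ ℂ^N`. -/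
def PqSmall (F : Type) [Field F] (q : F) (N : ℕ) :
    Matrix (Fin N × Fin N) (Fin N × Fin N) F := Matrix.of fun p r =>
  if r.1 = p.2 ∧ r.2 = p.1 then (if p.1 = p.2 then 1 else if p.2 < p.1 then q else q⁻¹)
  else 0

/-- The hypothesis that `Pq` is the extension of the q-permutation operators along
reduced decompositions: `P^q_{σ s_i} = P^q_σ P^q_{s_i}` whenever the length grows. -/
def PqExt (F : Type) [Field F] (q : F) (N r : ℕ)
    (Pq : Equiv.Perm (Fin r) → Matrix (Fin r → Fin N) (Fin r → Fin N) F) : Prop :=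
  Pq 1 = 1 ∧
    ∀ (σ : Equiv.Perm (Fin r)) (i : ℕ) (h : i + 1 < r),
      invCount (σ * Equiv.swap ⟨i, Nat.lt_of_succ_lt h⟩ ⟨i + 1, h⟩) = invCount σ + 1 →
        Pq (σ * Equiv.swap ⟨i, Nat.lt_of_succ_lt h⟩ ⟨i + 1, h⟩) =
          Pq σ * big2 F ⟨i, Nat.lt_of_succ_lt h⟩ ⟨i + 1, h⟩ (PqSmall F q N)

/-- The q-antisymmetrizer `A^q_r = Σ_σ sgn(σ) P^q_σ`. -/
def AqM (F : Type) [Field F] {N r : ℕ}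
    (Pq : Equiv.Perm (Fin r) → Matrix (Fin r → Fin N) (Fin r → Fin N) F) :
    Matrix (Fin r → Fin N) (Fin r → Fin N) F :=
  ∑ σ : Equiv.Perm (Fin r), ((Equiv.Perm.sign σ : ℤ) : F) • Pq σ

/-- A matrix acting in the `k`-th factor of `(ℂ^N)^{⊗ N}`, with entries in `A`. -/
def ampAt {A : Type} [Ring A] {N : ℕ} (k : Fin N) (M : Matrix (Fin N) (Fin N) A) :
    Matrix (Fin N → Fin N) (Fin N → Fin N) A :=
  Matrix.of fun f g => if ∀ l, l ≠ k → f l = g l then M (f k) (g k) else 0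

/-- A scalar two-site operator viewed over `A`, acting at sites `i`, `j`. -/
def big2A (F : Type) [Field F] {A : Type} [Ring A] [Algebra F A] {N : ℕ} (i j : Fin N)
    (M : Matrix (Fin N × Fin N) (Fin N × Fin N) F) :
    Matrix (Fin N → Fin N) (Fin N → Fin N) A :=
  (big2 F i j M).map (algebraMap F A)

/-- Coefficient of `u^m` in a product of formal series, each of which is supported in
degrees `≤ 1`; the series are given by their coefficient functions `ℤ → M`. -/
def seriesProdCoeff {M : Type} [Ring M] : List (ℤ → M) → ℤ → M
  | [], m => if m = 0 then 1 else 0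
  | c :: t, m => ∑ k ∈ Finset.Icc (m - t.length) 1, c k * seriesProdCoeff t (m - k)

/-! Series factors entering the Sklyanin determinant. -/

/-- The matrix `S^{(r)}` of the coefficients of `S(u)` (orthogonal case). -/
def SmatA (F : Type) [Field F] (q : F) (N : ℕ) (r : ℕ) :
    Matrix (Fin N) (Fin N) (UqAff F q N) :=
  Matrix.of fun i j => Scoef F q N r i j

/-- The series `S_k(q^{-2k+2} u)` acting at site `k` (0-based `k`), coefficientwise. -/
def SfacO (F : Type) [Field F] (q : F) (N : ℕ) (k : Fin N) (m : ℤ) :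
    Matrix (Fin N → Fin N) (Fin N → Fin N) (UqAff F q N) :=
  if m ≤ 0 then q ^ (2 * (k.val : ℤ) * (-m)) • ampAt k (SmatA F q N (-m).toNat) else 0

/-- The series `R_{ij}ᵗ((q^{-2i+2}u)⁻¹, q^{-2j+2}u)` (0-based `i`, `j`), coefficientwise. -/
def RtfacO (F : Type) [Field F] (q : F) (N : ℕ) (i j : Fin N) (m : ℤ) :
    Matrix (Fin N → Fin N) (Fin N → Fin N) (UqAff F q N) :=
  if m = -1 then q ^ (2 * (i.val : ℤ)) • big2A F i j (Rtilt F q N)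
  else if m = 1 then (-(q ^ (-2 * (j.val : ℤ)))) • big2A F i j (Rct F q N)
  else 0

/-- The ordered list of factors `S₁(u) R₁₂ᵗ ⋯ R₁Nᵗ S₂(q⁻²u) ⋯ S_N(q^{-2N+2}u)`. -/
def sdetFacsO (F : Type) [Field F] (q : F) (N : ℕ) :
    List (ℤ → Matrix (Fin N → Fin N) (Fin N → Fin N) (UqAff F q N)) :=
  (List.finRange N).flatMap fun i =>
    SfacO F q N i :: (((List.finRange N).filter fun j => i < j).map fun j => RtfacO F q N i j)

/-- The matrix `S^{(r)}` of the coefficients of `S(u)` (symplectic case). -/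
def SmatASp (F : Type) [Field F] (q : F) (n : ℕ) (r : ℕ) :
    Matrix (Fin (2 * n)) (Fin (2 * n)) (UqAff F q (2 * n)) :=
  Matrix.of fun i j => ScoefSp F q n r i j

def SfacSp (F : Type) [Field F] (q : F) (n : ℕ) (k : Fin (2 * n)) (m : ℤ) :
    Matrix (Fin (2 * n) → Fin (2 * n)) (Fin (2 * n) → Fin (2 * n)) (UqAff F q (2 * n)) :=
  if m ≤ 0 then q ^ (2 * (k.val : ℤ) * (-m)) • ampAt k (SmatASp F q n (-m).toNat) else 0

def sdetFacsSp (F : Type) [Field F] (q : F) (n : ℕ) :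
    List (ℤ → Matrix (Fin (2 * n) → Fin (2 * n)) (Fin (2 * n) → Fin (2 * n))
      (UqAff F q (2 * n))) :=
  (List.finRange (2 * n)).flatMap fun i =>
    SfacSp F q n i ::
      (((List.finRange (2 * n)).filter fun j => i < j).map fun j => RtfacO F q (2 * n) i j)

/-- Coefficientwise quantum determinant `qdet T(u)`:
the coefficient of `u^m` (nonzero only for `m ≤ 0`). -/
def qdetTc (F : Type) [Field F] (q : F) (N : ℕ) (m : ℤ) : UqAff F q N :=
  if m ≤ 0 then
    ∑ σ : Equiv.Perm (Fin N), ∑ rv ∈ Finset.Nat.antidiagonalTuple N (-m).toNat,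
      (((-q)⁻¹ ^ invCount σ) * ∏ k : Fin N, q ^ (2 * (k.val : ℤ) * (rv k : ℤ))) •
        ((List.finRange N).map fun k => tA F q N (rv k) (σ k) k).prod
  else 0

/-- Coefficientwise quantum determinant `qdet T̄(q^{2N-2} u⁻¹)`:
the coefficient of `u^m` (nonzero only for `m ≤ 0`). -/
def qdetTbc (F : Type) [Field F] (q : F) (N : ℕ) (m : ℤ) : UqAff F q N :=
  if m ≤ 0 then
    ∑ σ : Equiv.Perm (Fin N), ∑ rv ∈ Finset.Nat.antidiagonalTuple N (-m).toNat,
      (((-q)⁻¹ ^ invCount σ) *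
          ∏ k : Fin N, q ^ ((2 * (N : ℤ) - 2 - 2 * (k.val : ℤ)) * (rv k : ℤ))) •
        ((List.finRange N).map fun k => tbA F q N (rv k) (σ k) k).prod
  else 0

/-- The linear factor `q^{2i-2}u⁻¹ - q^{-2j+2}u` of `γ_N(u)` (0-based `i`, `j`),
viewed as an `A`-valued series. -/
def gamFac (F : Type) [Field F] (q : F) (N : ℕ) (p : Fin N × Fin N) (m : ℤ) : UqAff F q N :=
  if m = -1 then algebraMap F _ (q ^ (2 * (p.1.val : ℤ)))
  else if m = 1 then algebraMap F _ (-(q ^ (-2 * (p.2.val : ℤ)))) else 0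

/-- The list of series whose product is `γ_N(u) qdet T(u) qdet T̄(q^{2N-2}u⁻¹)`
in the orthogonal case. -/
def rhsO (F : Type) [Field F] (q : F) (N : ℕ) : List (ℤ → UqAff F q N) :=
  ((pairsLex N).map fun p => gamFac F q N p) ++ [qdetTc F q N, qdetTbc F q N]

/-- The entries of `S̄ = T̄ Tᵗ`, expressed inside `U^tw_q(o_N)`:
`S̄` is upper triangular with ones on the diagonal and `s̄_ij = q s_ji` for `i < j`. -/
def sbarOS (N : ℕ) (i j : Fin N) : AlgOS FF qq N :=
  if i = j then 1 else if i < j then algebraMap FF _ qq * sOS FF qq N j i else 0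

section BraidRelations

variable {F M : Type*} [Field F] [AddCommGroup M] [Module F M]

/-- `g` and `g'` satisfy the relations of the Hecke algebra of type `A₂` with parameter `c`, and
`h`, `h'` are their inverses. -/
structure IsHeckePair (c : F) (g h g' h' : Module.End F M) : Prop where
  eq_sub : ∀ x, h x = g x - c • x
  eq_sub' : ∀ x, h' x = g' x - c • x
  right_inv : ∀ x, g (h x) = x
  left_inv : ∀ x, h (g x) = x
  right_inv' : ∀ x, g' (h' x) = x
  left_inv' : ∀ x, h' (g' x) = x
  braid : ∀ x, g (g' (g x)) = g' (g (g' x))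

namespace IsHeckePair

variable {c : F} {g h g' h' : Module.End F M}

lemma pos_pos_neg (H : IsHeckePair c g h g' h') (x : M) : g (g' (h x)) = h' (g (g' x)) := by
  rw [← H.left_inv' (g (g' (h x))), ← H.braid, H.right_inv]

lemma pos_neg_neg (H : IsHeckePair c g h g' h') (x : M) : g (h' (h x)) = h' (h (g' x)) := by
  obtain ⟨y, rfl⟩ : ∃ y, x = g (g' y) := ⟨h' (h x), by rw [H.right_inv', H.right_inv]⟩
  rw [H.left_inv, H.left_inv', ← H.braid, H.left_inv, H.left_inv']

lemma neg_neg_neg (H : IsHeckePair c g h g' h') (x : M) : h (h' (h x)) = h' (h (h' x)) := by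
  obtain ⟨y, rfl⟩ : ∃ y, x = g (g' (g y)) :=
    ⟨h (h' (h x)), by rw [H.right_inv, H.right_inv', H.right_inv]⟩
  rw [H.left_inv, H.left_inv', H.left_inv, H.braid, H.left_inv', H.left_inv, H.left_inv']

lemma pos_pos (H : IsHeckePair c g h g' h') (x : M) : g (g x) = c • g x + x := by
  have := H.right_inv x
  rw [H.eq_sub, map_sub, map_smul] at this
  linear_combination (norm := module) this

lemma neg_neg (H : IsHeckePair c g h g' h') (x : M) : h (h x) = x - c • h x := by
  rw [H.eq_sub (h x), H.right_inv]

/-- `g' h` acts on `w` as `h h'` on `g g' w`. -/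
lemma pos_neg (H : IsHeckePair c g h g' h') (x : M) : g' (h x) = h (h' (g (g' x))) := by
  rw [← H.pos_pos_neg, H.left_inv]

lemma neg_pos_neg (H : IsHeckePair c g h g' h') (x : M) :
    h' (g (h' (g (g' x)))) = c • h' (h' (g (g' x))) + h x := by
  rw [← H.pos_pos_neg, H.pos_pos, map_add, map_smul, H.left_inv', H.pos_pos_neg]

end IsHeckePair

/-- The coefficient of `u⁻ᵏ` in the operator series `1 + u⁻¹ h`. -/
def evalCoeff (h : Module.End F M) (k : ℤ) : Module.End F M :=
  if k = 0 then 1 else if k = 1 then h else 0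

/-- Coefficientwise affine reflection equation in braid form, for vectors obtained by
Baxterization from a solution `w` of the constant reflection equation. -/
lemma braid_affine_reflection {c : F} {g₁ h₁ g₂ h₂ g₃ h₃ : Module.End F M}
    (H₁ : IsHeckePair c g₁ h₁ g₂ h₂) (H₃ : IsHeckePair c g₃ h₃ g₂ h₂)
    (hcomm : ∀ x, g₁ (g₃ x) = g₃ (g₁ x)) {w : M} (hw : g₁ (g₂ w) = g₃ (g₂ w))
    {ψ ψ' : ℤ → ℤ → M} (hψ : ∀ k l, ψ k l = evalCoeff h₁ k (evalCoeff h₃ l w))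
    (hψ' : ∀ k l, ψ' k l = evalCoeff h₃ k (evalCoeff h₁ l w)) (a b : ℤ) :
    h₁ (h₂ (ψ (-a) (-b))) - h₁ (g₂ (ψ (1 - a) (1 - b))) - g₁ (h₂ (ψ (-1 - a) (1 - b)))
        + g₁ (g₂ (ψ (-a) (2 - b)))
      = h₃ (h₂ (ψ' (-a) (-b))) - h₃ (g₂ (ψ' (1 - a) (1 - b)))
        - g₃ (h₂ (ψ' (-1 - a) (1 - b))) + g₃ (g₂ (ψ' (-a) (2 - b))) := by
  have hgh (x : M) : g₁ (h₃ x) = h₃ (g₁ x) := by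
    simp only [H₃.eq_sub, map_sub, map_smul, hcomm]
  have hhg (x : M) : h₁ (g₃ x) = g₃ (h₁ x) := by
    simp only [H₁.eq_sub, map_sub, map_smul, hcomm]
  have hhh (x : M) : h₁ (h₃ x) = h₃ (h₁ x) := by
    simp only [H₁.eq_sub, map_sub, map_smul, hgh]
  -- the coefficients are indexed by the exponents of the two factors of `w`
  have d₁₀ : g₁ (g₂ (h₁ w)) = g₃ (g₂ (h₃ w)) := by
    rw [H₁.pos_pos_neg, H₃.pos_pos_neg, hw]
  have b₀₀ : h₁ (g₂ w) = h₃ (g₂ w) := by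
    rw [H₁.eq_sub, H₃.eq_sub, hw]
  have c₁₀ : g₁ (h₂ (h₁ w)) = g₃ (h₂ (h₃ w)) := by
    rw [H₁.pos_neg_neg, H₃.pos_neg_neg, b₀₀]
  have b₀₁ : h₁ (g₂ (h₃ w)) = h₃ (g₂ (h₁ w)) := by
    rw [H₁.pos_neg, H₃.pos_neg, hw, hhh]
  have a₀₁ : h₁ (h₂ (h₃ w)) = h₃ (h₂ (h₁ w)) := by
    rw [H₁.eq_sub' (h₃ w), H₁.eq_sub' (h₁ w), map_sub, map_sub, map_smul, map_smul, b₀₁, hhh]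
  have c₁₁ : g₁ (h₂ (h₁ (h₃ w))) = g₃ (h₂ (h₃ (h₁ w))) := by
    rw [H₁.pos_neg_neg, H₃.pos_neg_neg, H₁.pos_neg, H₃.pos_neg, hw, hhh]
  have a₁₁ : h₁ (h₂ (h₁ (h₃ w))) = h₃ (h₂ (h₃ (h₁ w))) := by
    rw [H₁.neg_neg_neg, H₃.neg_neg_neg, a₀₁]
  have d₀₁ : g₁ (g₂ (h₃ w)) - h₁ (g₂ (h₁ w)) = g₃ (g₂ (h₁ w)) - h₃ (g₂ (h₃ w)) := by
    rw [H₁.pos_neg, H₃.pos_neg, ← hw, H₁.neg_neg, H₃.neg_neg, hgh, ← hhg, hhg]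
    simp only [H₁.eq_sub, H₃.eq_sub, map_sub, map_smul]
    module
  have d₁₁ : g₁ (g₂ (h₁ (h₃ w))) - g₁ (h₂ w) = g₃ (g₂ (h₃ (h₁ w))) - g₃ (h₂ w) := by
    have e₁ := H₁.neg_pos_neg w
    have e₃ := H₃.neg_pos_neg w
    rw [← hw] at e₃
    rw [H₁.pos_pos_neg, H₃.pos_pos_neg, H₁.pos_neg, H₃.pos_neg, ← hw, H₁.eq_sub' w]
    simp only [H₁.eq_sub, H₃.eq_sub, map_sub, map_smul, hcomm] at e₁ e₃ ⊢
    linear_combination (norm := module) (-c) • e₁ + c • e₃ - hw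
  have a₀₀ : h₁ (h₂ w) - h₁ (g₂ (h₁ (h₃ w))) = h₃ (h₂ w) - h₃ (g₂ (h₃ (h₁ w))) := by
    rw [H₁.eq_sub (h₂ w), H₃.eq_sub (h₂ w), H₁.eq_sub (g₂ _), H₃.eq_sub (g₂ _), hhh]
    rw [hhh] at d₁₁
    linear_combination (norm := module) -d₁₁
  have a₁₀ : h₁ (h₂ (h₁ w)) - g₁ (h₂ (h₃ w)) = h₃ (h₂ (h₃ w)) - g₃ (h₂ (h₁ w)) := by
    rw [H₁.eq_sub (h₂ _), H₃.eq_sub (h₂ _)] at a₀₁ ⊢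
    linear_combination (norm := module) c₁₀ - a₀₁
  by_cases ha : -2 ≤ a ∧ a ≤ 1
  · by_cases hb : -1 ≤ b ∧ b ≤ 2
    · obtain ⟨ha₁, ha₂⟩ := ha
      obtain ⟨hb₁, hb₂⟩ := hb
      simp only [hψ, hψ', evalCoeff]
      interval_cases a <;> interval_cases b <;> norm_num [neg_add_eq_sub] <;> assumption
    · have hz (x : ℤ) (h : x = -b ∨ x = 1 - b ∨ x = 2 - b) (f : Module.End F M) :
          evalCoeff f x = 0 := by
        rw [evalCoeff, if_neg (by omega), if_neg (by omega)]
      simp [hψ, hψ', hz]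
  · have hz (x : ℤ) (h : x = -a ∨ x = 1 - a ∨ x = -1 - a) (f : Module.End F M) :
        evalCoeff f x = 0 := by
      rw [evalCoeff, if_neg (by omega), if_neg (by omega)]
    simp [hψ, hψ', hz]

end BraidRelations

section TensorAction

variable {F : Type} [Field F] {N : ℕ} {V : Type*} [AddCommGroup V] [Module F V]

/-- The action of `P K` on `ℂ^N ⊗ ℂ^N ⊗ V`, where `P` is the permutation operator. -/
def braidAct (K : Matrix (Fin N × Fin N) (Fin N × Fin N) F) :
    Module.End F (Fin N → Fin N → V) where
  toFun f i a := ∑ x, ∑ y, K (a, i) (x, y) • f x y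
  map_add' f g := by
    ext i a
    simp only [Pi.add_apply, smul_add, Finset.sum_add_distrib]
  map_smul' c f := by
    ext i a
    simp only [Pi.smul_apply, Finset.smul_sum, RingHom.id_apply, smul_comm c]

lemma braidAct_apply (K : Matrix (Fin N × Fin N) (Fin N × Fin N) F) (f : Fin N → Fin N → V)
    (i a : Fin N) : braidAct K f i a = ∑ x, ∑ y, K (a, i) (x, y) • f x y := rfl

lemma braidAct_Rc (q : F) (f : Fin N → Fin N → V) (i a : Fin N) :
    braidAct (Rc F q N) f i a =
      if i = a then q • f i a else f a i + if a < i then (q - q⁻¹) • f i a else 0 := by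
  simp only [braidAct_apply, Rc, Matrix.of_apply, Prod.mk.injEq, add_smul _ _ (f _ _), ite_and,
    ite_smul, zero_smul, Finset.sum_add_distrib, Finset.sum_ite_eq, Finset.mem_univ, if_true]
  by_cases h : i = a
  · simp [h]
  · simp [h, Ne.symm h]

lemma Rtil_eq_Rc_sub (q : F) (p r : Fin N × Fin N) :
    Rtil F q N p r = Rc F q N p r - if p.1 = r.2 ∧ p.2 = r.1 then q - q⁻¹ else 0 := by
  obtain ⟨i, j⟩ := p
  obtain ⟨k, l⟩ := r
  simp only [Rc, Rtil, Matrix.of_apply, Prod.mk.injEq]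
  by_cases h₁ : i = l ∧ j = k
  · obtain ⟨rfl, rfl⟩ := h₁
    rcases lt_trichotomy i j with h | rfl | h
    · simp [h, h.ne, h.not_gt]
    · simp
    · simp [h, h.ne', h.not_gt]
  · by_cases h₂ : i = k ∧ j = l
    · obtain ⟨rfl, rfl⟩ := h₂
      have h₃ : i ≠ j := by
        rintro rfl
        exact h₁ ⟨rfl, rfl⟩
      simp [h₃]
    · simp [h₁, h₂, ← and_assoc]

lemma braidAct_Rtil (q : F) (f : Fin N → Fin N → V) :
    braidAct (Rtil F q N) f = braidAct (Rc F q N) f - (q - q⁻¹) • f := by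
  ext i a
  simp only [braidAct_apply, Rtil_eq_Rc_sub, sub_smul _ _ (f _ _), Finset.sum_sub_distrib,
    Pi.sub_apply, Pi.smul_apply, ite_and, ite_smul, zero_smul, Finset.sum_ite_eq, Finset.mem_univ,
    if_true]

lemma braidAct_Rc_sq {q : F} (hq : q ≠ 0) (f : Fin N → Fin N → V) :
    braidAct (Rc F q N) (braidAct (Rc F q N) f) = (q - q⁻¹) • braidAct (Rc F q N) f + f := by
  ext i a
  simp only [braidAct_Rc, Pi.add_apply, Pi.smul_apply]
  rcases lt_trichotomy i a with h | rfl | h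
  · simp [h.ne, h.ne', h.not_gt, h, add_comm]
  · simp only [if_true]
    match_scalars
    field_simp
    ring
  · simp [h.ne, h.ne', h.not_gt, h]
    abel

lemma braidAct_Rc_braid {q : F} (hq : q ≠ 0) (f : Fin N → Fin N → Fin N → V) :
    braidAct (Rc F q N) ((braidAct (Rc F q N)).compLeft (Fin N) (braidAct (Rc F q N) f)) =
      (braidAct (Rc F q N)).compLeft (Fin N)
        (braidAct (Rc F q N) ((braidAct (Rc F q N)).compLeft (Fin N) f)) := by
  have key (f : Fin N → Fin N → Fin N → V) (i j k : Fin N) :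
      braidAct (Rc F q N) f i j k =
        if i = j then q • f i j k else f j i k + if j < i then (q - q⁻¹) • f i j k else 0 := by
    rw [braidAct_Rc]
    split_ifs <;> simp
  ext i j k
  simp only [LinearMap.compLeft_apply, Function.comp_def, braidAct_Rc (V := V), key]
  rcases lt_trichotomy i j with h | h | h <;> rcases lt_trichotomy j k with h' | h' | h' <;>
    rcases lt_trichotomy i k with h'' | h'' | h'' <;> first | omega | skip
  all_goals
    try subst h
    try subst h'
    try subst h''
  all_goals
    simp [*, ne_of_lt, ne_of_gt, not_lt_of_gt]
    try module
  all_goals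
    match_scalars <;> field_simp
    try ring

lemma isHeckePair_braidAct {q : F} (hq : q ≠ 0) :
    IsHeckePair (M := Fin N → Fin N → Fin N → V) (q - q⁻¹)
      (braidAct (Rc F q N)) (braidAct (Rtil F q N))
      ((braidAct (Rc F q N)).compLeft (Fin N)) ((braidAct (Rtil F q N)).compLeft (Fin N)) := by
  have hr {W : Type _} [AddCommGroup W] [Module F W] (f : Fin N → Fin N → W) :
      braidAct (Rc F q N) (braidAct (Rtil F q N) f) = f := by
    rw [braidAct_Rtil, map_sub, map_smul, braidAct_Rc_sq hq, add_sub_cancel_left]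
  have hl {W : Type _} [AddCommGroup W] [Module F W] (f : Fin N → Fin N → W) :
      braidAct (Rtil F q N) (braidAct (Rc F q N) f) = f := by
    rw [braidAct_Rtil, braidAct_Rc_sq hq, add_sub_cancel_left]
  exact
    { eq_sub := braidAct_Rtil q
      eq_sub' := fun f => funext fun i => braidAct_Rtil q (f i)
      right_inv := hr
      left_inv := hl
      right_inv' := fun f => funext fun i => hr (f i)
      left_inv' := fun f => funext fun i => hl (f i)
      braid := braidAct_Rc_braid hq }

lemma braidAct_compLeft_comm (K : Matrix (Fin N × Fin N) (Fin N × Fin N) F) (T : Module.End F V)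
    (f : Fin N → Fin N → V) :
    braidAct K ((T.compLeft (Fin N)).compLeft (Fin N) f) =
      (T.compLeft (Fin N)).compLeft (Fin N) (braidAct K f) := by
  ext i a
  simp only [braidAct_apply, LinearMap.compLeft_apply, Function.comp_apply, map_sum, map_smul]

end TensorAction

/-- Acting with a Hecke pair pointwise on functions, and exchanging its two members. -/
lemma IsHeckePair.compLeft_symm {F M : Type*} [Field F] [AddCommGroup M] [Module F M] {c : F}
    {g h g' h' : Module.End F M} (H : IsHeckePair c g h g' h') (ι : Type*) :
    IsHeckePair c (g'.compLeft ι) (h'.compLeft ι) (g.compLeft ι) (h.compLeft ι) where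
  eq_sub f := funext fun i => H.eq_sub' (f i)
  eq_sub' f := funext fun i => H.eq_sub (f i)
  right_inv f := funext fun i => H.right_inv' (f i)
  left_inv f := funext fun i => H.left_inv' (f i)
  right_inv' f := funext fun i => H.right_inv (f i)
  left_inv' f := funext fun i => H.left_inv (f i)
  braid f := funext fun i => (H.braid (f i)).symm

section ReflectionEquation

variable {F : Type} [Field F] {N : ℕ} {A : Type} [Ring A] [Algebra F A]

/-- The vector `X ⊗ Y` attached to two arrays of elements of `A`. -/
def tensorVec (X Y : Fin N → Fin N → A) : Fin N → Fin N → Fin N → Fin N → A :=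
  fun i a j b => X i a * Y j b

lemma evalCoeff_tensorVec (K : Matrix (Fin N × Fin N) (Fin N × Fin N) F) (k : ℤ)
    (X Y : Fin N → Fin N → A) :
    evalCoeff (braidAct K) k (tensorVec X Y) = tensorVec (evalCoeff (braidAct K) k X) Y := by
  unfold evalCoeff
  split_ifs
  · rfl
  · ext i a j b
    simp [tensorVec, braidAct_apply, Finset.sum_mul]
  · ext i a j b
    simp [tensorVec]

lemma evalCoeff_compLeft_tensorVec (K : Matrix (Fin N × Fin N) (Fin N × Fin N) F) (k : ℤ)
    (X Y : Fin N → Fin N → A) :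
    evalCoeff (((braidAct K).compLeft (Fin N)).compLeft (Fin N)) k (tensorVec X Y) =
      tensorVec X (evalCoeff (braidAct K) k Y) := by
  unfold evalCoeff
  split_ifs
  · rfl
  · ext i a j b
    simp [tensorVec, braidAct_apply, Finset.mul_sum]
  · ext i a j b
    simp [tensorVec]

lemma amp1_zero : amp1 (0 : Matrix (Fin N) (Fin N) A) = 0 := by
  ext p r
  simp [amp1]

lemma amp2_zero : amp2 (0 : Matrix (Fin N) (Fin N) A) = 0 := by
  ext p r
  simp [amp2]

lemma mul_amp1_apply (M : Matrix (Fin N × Fin N) (Fin N × Fin N) A)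
    (X : Matrix (Fin N) (Fin N) A) (p : Fin N × Fin N) (z y : Fin N) :
    (M * amp1 X) p (z, y) = ∑ x, M p (x, y) * X x z := by
  simp [Matrix.mul_apply, amp1, Fintype.sum_prod_type]

lemma amp1_mul_apply (M : Matrix (Fin N × Fin N) (Fin N × Fin N) A)
    (X : Matrix (Fin N) (Fin N) A) (x y : Fin N) (r : Fin N × Fin N) :
    (amp1 X * M) (x, y) r = ∑ z, X x z * M (z, y) r := by
  simp [Matrix.mul_apply, amp1, Fintype.sum_prod_type_right]

lemma mul_amp2_apply (M : Matrix (Fin N × Fin N) (Fin N × Fin N) A)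
    (Y : Matrix (Fin N) (Fin N) A) (p : Fin N × Fin N) (z y : Fin N) :
    (M * amp2 Y) p (z, y) = ∑ x, M p (z, x) * Y x y := by
  simp [Matrix.mul_apply, amp2, Fintype.sum_prod_type]

lemma amp2_mul_apply (M : Matrix (Fin N × Fin N) (Fin N × Fin N) A)
    (Y : Matrix (Fin N) (Fin N) A) (i j : Fin N) (r : Fin N × Fin N) :
    (amp2 Y * M) (i, j) r = ∑ m, Y j m * M (i, m) r := by
  simp [Matrix.mul_apply, amp2, Fintype.sum_prod_type]

/-- Entries of `K X₁ K'ᵗ Y₂`, where `L = K'ᵗ` is the partial transpose. -/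
lemma refl_left_apply {K K' L : Matrix (Fin N × Fin N) (Fin N × Fin N) F}
    (hL : ∀ p r, L p r = K' (r.1, p.2) (p.1, r.2)) (X Y : Fin N → Fin N → A)
    (i j a b : Fin N) :
    (liftF F K * amp1 (Matrix.of X) * liftF F L * amp2 (Matrix.of Y) : Matrix _ _ A) (i, j) (a, b) =
      braidAct K ((braidAct K').compLeft (Fin N) (tensorVec X Y)) j i a b := by
  rw [Matrix.mul_assoc, Matrix.mul_assoc]
  simp only [Matrix.mul_apply (M := liftF F K), Fintype.sum_prod_type, amp1_mul_apply,
    mul_amp2_apply]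
  simp only [liftF, Matrix.map_apply, Matrix.of_apply, hL, braidAct_apply, LinearMap.compLeft_apply,
    Function.comp_def, Finset.sum_apply, Pi.smul_apply, tensorVec, Finset.mul_sum, Finset.smul_sum,
    ← Algebra.smul_def, mul_smul_comm]
  simp only [smul_comm (K (i, j) _)]

/-- Entries of `Y₂ K'ᵗ X₁ K`, where `L = K'ᵗ` is the partial transpose. -/
lemma refl_right_apply {K K' L : Matrix (Fin N × Fin N) (Fin N × Fin N) F}
    (hL : ∀ p r, L p r = K' (r.1, p.2) (p.1, r.2)) (hK : ∀ p r, K p r = K r.swap p.swap)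
    (hK' : ∀ p r, K' p r = K' r.swap p.swap) (X Y : Fin N → Fin N → A)
    (i j a b : Fin N) :
    (amp2 (Matrix.of Y) * liftF F L * amp1 (Matrix.of X) * liftF F K : Matrix _ _ A) (i, j) (a, b) =
      ((braidAct K).compLeft (Fin N)).compLeft (Fin N)
        ((braidAct K').compLeft (Fin N) (tensorVec Y X)) j i a b := by
  simp only [Matrix.mul_apply (N := liftF F K), Fintype.sum_prod_type, mul_amp1_apply,
    amp2_mul_apply]
  simp only [liftF, Matrix.map_apply, Matrix.of_apply, hL, braidAct_apply, LinearMap.compLeft_apply,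
    Function.comp_def, Finset.sum_apply, Pi.smul_apply, tensorVec, Finset.sum_mul, Finset.smul_sum,
    ← Algebra.commutes, ← Algebra.smul_def, smul_mul_assoc]
  rw [Finset.sum_comm]
  refine Finset.sum_congr rfl fun k _ => Finset.sum_congr rfl fun y _ => ?_
  rw [Finset.sum_comm]
  refine Finset.sum_congr rfl fun m _ => Finset.sum_congr rfl fun x _ => ?_
  rw [hK (y, k), hK' (x, m)]
  rfl

lemma Rc_swap (q : F) (p r : Fin N × Fin N) : Rc F q N p r = Rc F q N r.swap p.swap := by
  obtain ⟨i, j⟩ := p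
  obtain ⟨k, l⟩ := r
  simp only [Rc, Matrix.of_apply, Prod.swap_prod_mk, Prod.mk.injEq]
  split_ifs <;> grind

lemma Rtil_swap (q : F) (p r : Fin N × Fin N) : Rtil F q N p r = Rtil F q N r.swap p.swap := by
  rw [Rtil_eq_Rc_sub, Rtil_eq_Rc_sub, Rc_swap]
  simp [eq_comm]

/-- The coefficients of the Baxterization `S + u⁻¹ Ř⁻¹ S` of an array `S`. -/
def evalMatrix (q : F) (S : Fin N → Fin N → A) (r : ℕ) : Matrix (Fin N) (Fin N) A :=
  Matrix.of (evalCoeff (braidAct (Rtil F q N)) r S)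

/-- The Baxterization of a solution of the reflection equation solves the affine reflection
equation. -/
theorem affLHS_evalMatrix {q : F} (hq : q ≠ 0) {S : Fin N → Fin N → A}
    (hS : reflLHS F q (Matrix.of S) = reflRHS F q (Matrix.of S)) (a b : ℤ) :
    affLHS F q (evalMatrix q S) a b = affRHS F q (evalMatrix q S) a b := by
  let e (k : ℤ) : Fin N → Fin N → A := evalCoeff (braidAct (Rtil F q N)) k S
  have he (k : ℤ) (h₀ : k ≠ 0) (h₁ : k ≠ 1) : e k = 0 := by
    simp only [e, evalCoeff, if_neg h₀, if_neg h₁]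
    rfl
  have hz₁ (k : ℤ) : z1 (evalMatrix q S) k = amp1 (Matrix.of (e k)) := by
    rcases lt_or_ge k 0 with hk | hk
    · rw [z1, if_neg hk.not_ge, he k (by omega) (by omega), Matrix.of_zero, amp1_zero]
    · rw [z1, if_pos hk, evalMatrix, Int.toNat_of_nonneg hk]
  have hz₂ (k : ℤ) : z2 (evalMatrix q S) k = amp2 (Matrix.of (e k)) := by
    rcases lt_or_ge k 0 with hk | hk
    · rw [z2, if_neg hk.not_ge, he k (by omega) (by omega), Matrix.of_zero, amp2_zero]
    · rw [z2, if_pos hk, evalMatrix, Int.toNat_of_nonneg hk]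
  have hw : braidAct (Rc F q N) ((braidAct (Rc F q N)).compLeft (Fin N) (tensorVec S S)) =
      ((braidAct (Rc F q N)).compLeft (Fin N)).compLeft (Fin N)
        ((braidAct (Rc F q N)).compLeft (Fin N) (tensorVec S S)) := by
    ext j i a b
    rw [← refl_left_apply (L := Rct F q N) (fun _ _ => rfl),
      ← refl_right_apply (L := Rct F q N) (fun _ _ => rfl) (Rc_swap q) (Rc_swap q)]
    exact congrFun (congrFun hS (i, j)) (a, b)
  have hψ (k l : ℤ) : tensorVec (e k) (e l) = evalCoeff (braidAct (Rtil F q N)) k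
      (evalCoeff (((braidAct (Rtil F q N)).compLeft (Fin N)).compLeft (Fin N)) l
        (tensorVec S S)) := by
    rw [evalCoeff_compLeft_tensorVec, evalCoeff_tensorVec]
  have hψ' (k l : ℤ) : tensorVec (e l) (e k) =
      evalCoeff (((braidAct (Rtil F q N)).compLeft (Fin N)).compLeft (Fin N)) k
        (evalCoeff (braidAct (Rtil F q N)) l (tensorVec S S)) := by
    rw [evalCoeff_tensorVec, evalCoeff_compLeft_tensorVec]
  have key := braid_affine_reflection (isHeckePair_braidAct (V := Fin N → A) hq)
    ((isHeckePair_braidAct (V := A) hq).compLeft_symm (Fin N)) (braidAct_compLeft_comm _ _) hw hψ hψ' a b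
  ext ⟨i, j⟩ ⟨x, y⟩
  have := congrFun (congrFun (congrFun (congrFun key j) i) x) y
  simp only [affLHS, affRHS, Matrix.add_apply, Matrix.sub_apply, hz₁, hz₂]
  simp only [refl_left_apply (L := Rct F q N) (K' := Rc F q N) (fun _ _ => rfl),
    refl_left_apply (L := Rtilt F q N) (K' := Rtil F q N) (fun _ _ => rfl),
    refl_right_apply (L := Rct F q N) (K' := Rc F q N) (fun _ _ => rfl) (Rc_swap q) (Rc_swap q),
    refl_right_apply (L := Rct F q N) (K' := Rc F q N) (fun _ _ => rfl) (Rtil_swap q) (Rc_swap q),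
    refl_right_apply (L := Rtilt F q N) (K' := Rtil F q N) (fun _ _ => rfl) (Rc_swap q)
      (Rtil_swap q),
    refl_right_apply (L := Rtilt F q N) (K' := Rtil F q N) (fun _ _ => rfl) (Rtil_swap q)
      (Rtil_swap q)]
  simp only [Pi.add_apply, Pi.sub_apply] at this
  linear_combination (norm := abel) this

end ReflectionEquation

section Functoriality

variable {F : Type} [Field F] {N : ℕ} {A B : Type} [Ring A] [Algebra F A] [Ring B] [Algebra F B]
  (f : A →ₐ[F] B)

lemma liftF_map {m : Type} (M : Matrix m m F) : (liftF F M : Matrix m m A).map f = liftF F M := by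
  ext p r
  simp [liftF]

lemma amp1_map (M : Matrix (Fin N) (Fin N) A) : (amp1 M).map f = amp1 (M.map f) := by
  ext p r
  simp [amp1, apply_ite f]

lemma amp2_map (M : Matrix (Fin N) (Fin N) A) : (amp2 M).map f = amp2 (M.map f) := by
  ext p r
  simp [amp2, apply_ite f]

lemma z1_map (S : ℕ → Matrix (Fin N) (Fin N) A) (k : ℤ) :
    (z1 S k).map f = z1 (fun r => (S r).map f) k := by
  unfold z1
  split_ifs
  · exact amp1_map f _
  · exact Matrix.map_zero f (map_zero f)

lemma z2_map (S : ℕ → Matrix (Fin N) (Fin N) A) (k : ℤ) :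
    (z2 S k).map f = z2 (fun r => (S r).map f) k := by
  unfold z2
  split_ifs
  · exact amp2_map f _
  · exact Matrix.map_zero f (map_zero f)

lemma affLHS_map (q : F) (S : ℕ → Matrix (Fin N) (Fin N) A) (a b : ℤ) :
    (affLHS F q S a b).map f = affLHS F q (fun r => (S r).map f) a b := by
  simp only [affLHS, Matrix.map_add f (map_add f), Matrix.map_sub f (map_sub f), Matrix.map_mul,
    liftF_map, z1_map, z2_map]

lemma affRHS_map (q : F) (S : ℕ → Matrix (Fin N) (Fin N) A) (a b : ℤ) :
    (affRHS F q S a b).map f = affRHS F q (fun r => (S r).map f) a b := by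
  simp only [affRHS, Matrix.map_add f (map_add f), Matrix.map_sub f (map_sub f), Matrix.map_mul,
    liftF_map, z1_map, z2_map]

lemma reflLHS_map (q : F) (S : Matrix (Fin N) (Fin N) A) :
    (reflLHS F q S).map f = reflLHS F q (S.map f) := by
  simp only [reflLHS, Matrix.map_mul, liftF_map, amp1_map, amp2_map]

lemma reflRHS_map (q : F) (S : Matrix (Fin N) (Fin N) A) :
    (reflRHS F q S).map f = reflRHS F q (S.map f) := by
  simp only [reflRHS, Matrix.map_mul, liftF_map, amp1_map, amp2_map]

end Functoriality

lemma sOS_reflection (F : Type) [Field F] (q : F) (N : ℕ) :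
    reflLHS F q (Matrix.of (sOS F q N)) = reflRHS F q (Matrix.of (sOS F q N)) := by
  have h : (Sfree F N).map (RingQuot.mkAlgHom F (OSRel F q N)) = Matrix.of (sOS F q N) := rfl
  rw [← h, ← reflLHS_map, ← reflRHS_map]
  ext p r
  exact RingQuot.mkAlgHom_rel F (OSRel.refl p r)

lemma sOS_of_lt (F : Type) [Field F] (q : F) {N : ℕ} {i j : Fin N} (h : i < j) :
    sOS F q N i j = 0 :=
  (RingQuot.mkAlgHom_rel F (OSRel.tri i j h)).trans (map_zero _)

lemma sOS_self (F : Type) [Field F] (q : F) {N : ℕ} (i : Fin N) : sOS F q N i i = 1 :=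
  (RingQuot.mkAlgHom_rel F (OSRel.diag i)).trans (map_one _)

lemma qq_ne_zero : qq ≠ 0 := RatFunc.X_ne_zero

lemma braidAct_Rtil_sOS (N : ℕ) (i j : Fin N) :
    braidAct (Rtil FF qq N) (sOS FF qq N) i j = algebraMap FF _ qq⁻¹ * sbarOS N i j := by
  rw [braidAct_Rtil, Pi.sub_apply, Pi.sub_apply, Pi.smul_apply, Pi.smul_apply, braidAct_Rc, sbarOS,
    ← Algebra.smul_def]
  rcases lt_trichotomy i j with h | rfl | h
  · simp [h, h.ne, h.not_gt, sOS_of_lt FF qq h, ← Algebra.smul_def, smul_smul, qq_ne_zero]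
  · simp [sOS_self, ← sub_smul]
  · simp [h, h.ne', h.not_gt, sOS_of_lt FF qq h]

/-- The evaluation homomorphism on the free algebra on the coefficients of `S(u)`. -/
def evalFree (N : ℕ) : FreeAlgebra FF (ℕ × Fin N × Fin N) →ₐ[FF] AlgOS FF qq N :=
  FreeAlgebra.lift FF fun x => evalMatrix qq (sOS FF qq N) x.1 x.2.1 x.2.2

lemma evalFree_ι (N r : ℕ) (i j : Fin N) :
    evalFree N (FreeAlgebra.ι FF (r, i, j)) = evalMatrix qq (sOS FF qq N) r i j :=
  FreeAlgebra.lift_ι_apply _ _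

lemma SfreeA_map_evalFree (N : ℕ) :
    (fun r => (SfreeA FF N r).map (evalFree N)) = evalMatrix qq (sOS FF qq N) := by
  funext r i j
  exact evalFree_ι N r i j

lemma evalFree_eq_of_rel (N : ℕ) {x y : FreeAlgebra FF (ℕ × Fin N × Fin N)}
    (h : AORel FF qq N x y) : evalFree N x = evalFree N y := by
  induction h with
  | tri i j hij =>
    rw [map_zero]
    exact (evalFree_ι N 0 i j).trans (sOS_of_lt FF qq hij)
  | diag i =>
    rw [map_one]
    exact (evalFree_ι N 0 i i).trans (sOS_self FF qq i)
  | refl a b p r =>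
    have h := affLHS_evalMatrix qq_ne_zero (sOS_reflection FF qq N) a b
    rw [← SfreeA_map_evalFree, ← affLHS_map, ← affRHS_map] at h
    exact congrFun (congrFun h p) r

/-- The evaluation homomorphism `S(u) ↦ S + q⁻¹ u⁻¹ S̄`. -/
def evalHom (N : ℕ) : AlgAO FF qq N →ₐ[FF] AlgOS FF qq N :=
  RingQuot.liftAlgHom FF ⟨evalFree N, fun _ _ => evalFree_eq_of_rel N⟩

lemma evalHom_sAO (N r : ℕ) (i j : Fin N) :
    evalHom N (sAO FF qq N r i j) = evalMatrix qq (sOS FF qq N) r i j := by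
  rw [evalHom, sAO, RingQuot.liftAlgHom_mkAlgHom_apply, evalFree_ι]

lemma evalHom_surjective (N : ℕ) : Function.Surjective (evalHom N) := by
  have h : (evalHom N).comp (FreeAlgebra.lift FF fun x => sAO FF qq N 0 x.1 x.2) =
      RingQuot.mkAlgHom FF (OSRel FF qq N) := by
    ext x
    simp [evalHom_sAO, evalMatrix, evalCoeff, sOS]
  refine Function.Surjective.of_comp (g := FreeAlgebra.lift FF fun x : Fin N × Fin N => sAO FF qq N 0 x.1 x.2) ?_
  rw [← AlgHom.coe_comp, h]
  exact RingQuot.mkAlgHom_surjective FF (OSRel FF qq N)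

/-- The assignment `S(u) ↦ S + q⁻¹ u⁻¹ S̄` defines a surjective algebra
homomorphism (the evaluation homomorphism) `Y^tw_q(o_N) → U^tw_q(o_N)`. -/
theorem stmt14 (N : ℕ) :
    ∃ φ : AlgAO FF qq N →ₐ[FF] AlgOS FF qq N,
      Function.Surjective φ ∧
      (∀ i j : Fin N, φ (sAO FF qq N 0 i j) = sOS FF qq N i j) ∧
      (∀ i j : Fin N, φ (sAO FF qq N 1 i j) = algebraMap FF _ qq⁻¹ * sbarOS N i j) ∧
      ∀ (r : ℕ) (i j : Fin N), 2 ≤ r → φ (sAO FF qq N r i j) = 0 := by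
  refine ⟨evalHom N, evalHom_surjective N, fun i j => ?_, fun i j => ?_, fun r i j hr => ?_⟩
  · rw [evalHom_sAO]
    rfl
  · rw [evalHom_sAO, ← braidAct_Rtil_sOS]
    rfl
  · rw [evalHom_sAO, evalMatrix, evalCoeff, if_neg (by omega), if_neg (by omega)]
    rfl
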